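/- (Cayley–Bacharach, in the form used in the paper.) Let e ≥ 2 be an integer and let F₁, F₂ ∈ ℂ[X,Y,Z] be homogeneous polynomials of degree e whose common zero set W in ℙ² consists of exactly e² distinct points. Suppose W = W₁ ⊔ W₂ is a partition with |W₁| = binom(e+1, 2) and |W₂| = binom(e, 2). If the only homogeneous polynomial of degree e − 1 vanishing at every point of W₁ is 0, then the only homogeneous polynomial of degree e − 2 vanishing at every point of W₂ is 0. -/

import Mathlib

open MvPolynomial

noncomputable section

/-- The complex projective plane. -/
abbrev P2 : Type := Projectivization ℂ (Fin 3 → ℂ)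

/-- A (homogeneous) polynomial `G` vanishes at a point `p ∈ ℙ²`. -/
def VanAt (G : MvPolynomial (Fin 3) ℂ) (p : P2) : Prop :=
  eval p.rep G = 0

/-- The submodule of polynomials vanishing at every point of `S`. -/
def vanishing (S : Set P2) : Submodule ℂ (MvPolynomial (Fin 3) ℂ) where
  carrier := {G | ∀ p ∈ S, VanAt G p}
  add_mem' := by
    intro a b ha hb p hp
    have h1 := ha p hp
    have h2 := hb p hp
    simp only [VanAt] at h1 h2 ⊢
    simp [h1, h2]
  zero_mem' := by
    intro p hp
    simp [VanAt]
  smul_mem' := by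
    intro c G hG p hp
    have h1 := hG p hp
    simp only [VanAt] at h1 ⊢
    simp [h1]

/-- `V_k(S)`: homogeneous polynomials of degree `k` (together with `0`)
vanishing at every point of `S`. -/
def Vsp (k : ℕ) (S : Set P2) : Submodule ℂ (MvPolynomial (Fin 3) ℂ) :=
  homogeneousSubmodule (Fin 3) ℂ k ⊓ vanishing S

/-- `p` is a singular point of the curve `F = 0`. -/
def SingPt (F : MvPolynomial (Fin 3) ℂ) (p : P2) : Prop :=
  ∀ i : Fin 3, eval p.rep (pderiv i F) = 0

/-- `p` is a node of the curve `F = 0`. -/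
def IsNode (F : MvPolynomial (Fin 3) ℂ) (p : P2) : Prop :=
  SingPt F p ∧
    (Matrix.of fun i j : Fin 3 => eval p.rep (pderiv i (pderiv j F))).rank = 2

/-- The curve `F = 0` is nodal: every singular point is a node. -/
def Nodal (F : MvPolynomial (Fin 3) ℂ) : Prop :=
  ∀ p : P2, SingPt F p → IsNode F p

/-- The set of nodes of the curve `F = 0`. -/
def nodes (F : MvPolynomial (Fin 3) ℂ) : Set P2 :=
  {p | IsNode F p}

/-- The common zero set in `ℙ²` of two polynomials. -/
def zeroSet (F₁ F₂ : MvPolynomial (Fin 3) ℂ) : Set P2 :=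
  {p | VanAt F₁ p ∧ VanAt F₂ p}


lemma comp_mul {σ : Type*} (F : MvPolynomial σ ℂ) (e : ℕ) (hF : F.IsHomogeneous e)
    (a : MvPolynomial σ ℂ) (D : ℕ) :
    homogeneousComponent (D + e) (a * F) = homogeneousComponent D a * F := by
  conv_lhs => rw [← sum_homogeneousComponent a, Finset.sum_mul, map_sum]
  have : ∀ i ∈ Finset.range (a.totalDegree + 1),
      homogeneousComponent (D + e) (homogeneousComponent i a * F)
        = if i = D then homogeneousComponent D a * F else 0 := by
    intro i _
    have h := homogeneousComponent_of_mem (m := D + e)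
      (((homogeneousComponent_isHomogeneous i a).mul hF))
    rw [h]
    by_cases hi : i = D
    · simp [hi]
    · simp [hi, Ne.symm hi]
  rw [Finset.sum_congr rfl this, Finset.sum_ite_eq']
  split_ifs with h
  · rfl
  · rw [homogeneousComponent_eq_zero, zero_mul]
    simpa using h

lemma comp_top {σ : Type*} (p q : MvPolynomial σ ℂ) :
    homogeneousComponent (p.totalDegree + q.totalDegree) (p * q)
      = homogeneousComponent p.totalDegree p * homogeneousComponent q.totalDegree q := by
  have hpq : p * q
      = ∑ i ∈ Finset.range (p.totalDegree + 1), homogeneousComponent i p * q := by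
    rw [← Finset.sum_mul, sum_homogeneousComponent]
  rw [hpq, map_sum, Finset.sum_eq_single p.totalDegree]
  · rw [mul_comm, add_comm, comp_mul _ _ (homogeneousComponent_isHomogeneous _ p), mul_comm]
  · intro i hi hi'
    have hi2 : i < p.totalDegree := by
      simp at hi; omega
    apply homogeneousComponent_eq_zero
    have h1 := totalDegree_mul (homogeneousComponent i p) q
    have h2 := (homogeneousComponent_isHomogeneous i p).totalDegree_le
    omega
  · simp

lemma comp_top_ne {σ : Type*} (p : MvPolynomial σ ℂ) (hp : p ≠ 0) :
    homogeneousComponent p.totalDegree p ≠ 0 := by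
  obtain ⟨d, hd, hdeg⟩ := Finset.exists_mem_eq_sup p.support
    (by simpa using hp) (fun s => s.sum fun _ e => e)
  intro h
  have h2 := congrArg (coeff d) h
  rw [coeff_homogeneousComponent, if_pos] at h2
  · simp at hd; exact hd (by simpa using h2)
  · rw [totalDegree, hdeg]; rfl

lemma finrank_hom (n : ℕ) :
    Module.finrank ℂ (homogeneousSubmodule (Fin 3) ℂ n) = (n + 2).choose 2 := by
  classical
  rw [homogeneousSubmodule_eq_finsupp_supported]
  have e1 := (AddMonoidAlgebra.supportedEquivFinsupp (S := ℂ) (R := ℂ) {d : Fin 3 →₀ ℕ | d.degree = n}).finrank_eq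
  have hs : {d : Fin 3 →₀ ℕ | d.degree = n} = ↑(Finset.finsuppAntidiag (Finset.univ : Finset (Fin 3)) n) := by
    ext d
    simp [Finset.mem_finsuppAntidiag, Finsupp.degree_eq_sum]
  have e2 : Module.finrank ℂ ({d : Fin 3 →₀ ℕ | d.degree = n} →₀ ℂ) = (n + 2).choose 2 := by
    rw [hs, Module.finrank_finsupp_self]
    simp only [Finset.coe_sort_coe, Fintype.card_coe]
    rw [Finset.card_finsuppAntidiag_nat_eq_choose]
    simp
    rw [add_comm 2 n]
    exact Nat.choose_symm_add
  exact e1.trans e2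

lemma relprime_of_zeros (f g : MvPolynomial (Fin 2) ℂ)
    (h : ∀ v : Fin 2 → ℂ, eval v f = 0 → eval v g = 0 → v = 0) : IsRelPrime f g := by
  have hX : ∀ i : Fin 2, ∃ n : ℕ, (X i : MvPolynomial (Fin 2) ℂ) ^ n ∈ Ideal.span {f, g} := by
    intro i
    have : (X i : MvPolynomial (Fin 2) ℂ) ∈ (Ideal.span {f, g}).radical := by
      rw [← vanishingIdeal_zeroLocus_eq_radical (K := ℂ), mem_vanishingIdeal_iff]
      intro x hx
      rw [mem_zeroLocus_iff] at hx
      have hf := hx f (Ideal.subset_span (by simp))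
      have hg := hx g (Ideal.subset_span (by simp))
      have := h x (by simpa [aeval_eq_eval] using hf) (by simpa [aeval_eq_eval] using hg)
      simp [this]
    exact this
  obtain ⟨n, hn⟩ := hX 0
  obtain ⟨m, hm⟩ := hX 1
  have hrel : IsRelPrime ((X 0 : MvPolynomial (Fin 2) ℂ) ^ n) (X 1 ^ m) := by
    apply IsRelPrime.pow
    rw [(X_prime (R := ℂ) (i := (0 : Fin 2))).irreducible.isRelPrime_iff_not_dvd]
    simp
  intro d hf hg
  have key : ∀ q ∈ Ideal.span {f, g}, d ∣ q := by
    intro q hq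
    obtain ⟨a, b, rfl⟩ := Ideal.mem_span_pair.1 hq
    exact dvd_add (hf.mul_left _) (hg.mul_left _)
  exact hrel (key _ hn) (key _ hm)

/-- Restriction to the plane `z = α x + β y`. -/
def phi (α β : ℂ) : MvPolynomial (Fin 3) ℂ →ₐ[ℂ] MvPolynomial (Fin 2) ℂ :=
  aeval ![X 0, X 1, C α * X 0 + C β * X 1]

/-- A section of the restriction. -/
def psi : MvPolynomial (Fin 2) ℂ →ₐ[ℂ] MvPolynomial (Fin 3) ℂ :=
  aeval ![X 0, X 1]

/-- The linear form cutting out the plane. -/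
def ell (α β : ℂ) : MvPolynomial (Fin 3) ℂ := X 2 - (C α * X 0 + C β * X 1)

lemma phi_psi (α β : ℂ) (P : MvPolynomial (Fin 2) ℂ) : phi α β (psi P) = P := by
  have : (phi α β).comp psi = AlgHom.id ℂ _ := by
    ext i
    fin_cases i <;> simp [phi, psi]
  exact DFunLike.congr_fun this P

lemma phi_ell (α β : ℂ) : phi α β (ell α β) = 0 := by
  simp [phi, ell, algebraMap_eq]

lemma ell_hom (α β : ℂ) : (ell α β).IsHomogeneous 1 :=
  (isHomogeneous_X _ _).sub ((isHomogeneous_C_mul_X _ _).add (isHomogeneous_C_mul_X _ _))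

lemma ell_ne (α β : ℂ) : ell α β ≠ 0 := by
  intro h
  have := congrArg (eval ![0, 0, 1]) h
  simp [ell] at this

lemma ell_dvd_sub (α β : ℂ) (P : MvPolynomial (Fin 3) ℂ) : ell α β ∣ P - psi (phi α β P) := by
  induction P using MvPolynomial.induction_on with
  | C a => simp [← algebraMap_eq]
  | add p q hp hq =>
    have := dvd_add hp hq
    rw [map_add, map_add]
    convert this using 1
    ring
  | mul_X p i hp =>
    have hi : ell α β ∣ X i - psi (phi α β (X i)) := by
      fin_cases i <;> simp [phi, psi, ell, algebraMap_eq]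
    rw [map_mul, map_mul]
    have := dvd_add (hp.mul_right (X i)) (hi.mul_left (psi (phi α β p)))
    convert this using 1
    ring

lemma ell_dvd (α β : ℂ) (P : MvPolynomial (Fin 3) ℂ) (h : phi α β P = 0) : ell α β ∣ P := by
  simpa [h] using ell_dvd_sub α β P

lemma phi_hom (α β : ℂ) (P : MvPolynomial (Fin 3) ℂ) (n : ℕ) (h : P.IsHomogeneous n) :
    (phi α β P).IsHomogeneous n := by
  have := h.aeval (![X 0, X 1, C α * X 0 + C β * X 1] : Fin 3 → MvPolynomial (Fin 2) ℂ) (n := 1) (by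
    intro i
    fin_cases i
    · exact isHomogeneous_X _ _
    · exact isHomogeneous_X _ _
    · exact (isHomogeneous_C_mul_X _ _).add (isHomogeneous_C_mul_X _ _))
  simpa [phi] using this

lemma eval_phi (α β : ℂ) (P : MvPolynomial (Fin 3) ℂ) (v : Fin 2 → ℂ) :
    eval v (phi α β P) = eval ![v 0, v 1, α * v 0 + β * v 1] P := by
  have : (aeval v).comp (phi α β) = (aeval ![v 0, v 1, α * v 0 + β * v 1] :
      MvPolynomial (Fin 3) ℂ →ₐ[ℂ] ℂ) := by
    ext i
    fin_cases i <;> simp [phi]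
  simpa [aeval_eq_eval] using DFunLike.congr_fun this P

lemma hom_unit {σ : Type*} (P : MvPolynomial σ ℂ) (n : ℕ) (h : P.IsHomogeneous n)
    (hu : IsUnit P) : n = 0 := by
  have h1 : P.totalDegree = n := h.totalDegree hu.ne_zero
  obtain ⟨Q, hQ⟩ := hu.exists_right_inv
  have h2 : P.totalDegree + Q.totalDegree = 0 := by
    rw [← totalDegree_mul_of_isDomain hu.ne_zero (right_ne_zero_of_mul_eq_one hQ), hQ]
    simp
  omega

section regular
variable {e : ℕ} {F₁ F₂ : MvPolynomial (Fin 3) ℂ} {α β : ℂ}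

lemma ne_zero_of_rel (he : e ≠ 0) (h1 : F₁.IsHomogeneous e) 
    (hrel : IsRelPrime (phi α β F₁) (phi α β F₂)) : phi α β F₂ ≠ 0 := by
  intro h
  rw [h, isRelPrime_zero_right] at hrel
  exact he (hom_unit _ _ (phi_hom α β F₁ e h1) hrel)

lemma ell_regular (he : e ≠ 0) (h1 : F₁.IsHomogeneous e) 
    (hrel : IsRelPrime (phi α β F₁) (phi α β F₂)) (K a b : MvPolynomial (Fin 3) ℂ)
    (h : ell α β * K = a * F₁ + b * F₂) : ∃ a' b', K = a' * F₁ + b' * F₂ := by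
  have hne := ne_zero_of_rel he h1 hrel
  have h0 := congrArg (phi α β) h
  rw [map_mul, phi_ell, zero_mul, map_add, map_mul, map_mul] at h0
  have hd : phi α β F₂ ∣ phi α β a := by
    apply hrel.symm.dvd_of_dvd_mul_right
    exact ⟨- phi α β b, by linear_combination -h0⟩
  obtain ⟨m, hm⟩ := hd
  have hb : phi α β b = - (phi α β F₁ * m) := by
    apply mul_left_cancel₀ hne
    rw [hm] at h0
    linear_combination -h0
  obtain ⟨a', ha'⟩ := ell_dvd α β (a - F₂ * psi m) (by simp [phi_psi, hm])
  obtain ⟨b', hb'⟩ := ell_dvd α β (b + F₁ * psi m) (by simp [phi_psi, hb])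
  refine ⟨a', b', mul_left_cancel₀ (ell_ne α β) ?_⟩
  linear_combination h + F₁ * ha' + F₂ * hb'

lemma ell_pow_regular (he : e ≠ 0) (h1 : F₁.IsHomogeneous e) 
    (hrel : IsRelPrime (phi α β F₁) (phi α β F₂)) (j : ℕ) (K : MvPolynomial (Fin 3) ℂ)
    (h : ∃ a b, ell α β ^ j * K = a * F₁ + b * F₂) : ∃ a' b', K = a' * F₁ + b' * F₂ := by
  induction j with
  | zero => simpa using h
  | succ j ih =>
    obtain ⟨a, b, h⟩ := h
    exact ih (ell_regular he h1 hrel _ a b (by rw [← h]; ring))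

lemma rel3 (he : e ≠ 0) (h1 : F₁.IsHomogeneous e) (h2 : F₂.IsHomogeneous e)
    (hrel : IsRelPrime (phi α β F₁) (phi α β F₂)) : IsRelPrime F₁ F₂ := by
  have hn2 : F₂ ≠ 0 := fun h => ne_zero_of_rel he h1 hrel (by simp [h])
  have hn1 : F₁ ≠ 0 := fun h => ne_zero_of_rel he h2 hrel.symm (by simp [h])
  intro d hd1 hd2
  have key : ∀ F : MvPolynomial (Fin 3) ℂ, F.IsHomogeneous e → F ≠ 0 → d ∣ F →
      homogeneousComponent d.totalDegree d ∣ F := by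
    rintro _ hF hn ⟨q, rfl⟩
    have hd0 := left_ne_zero_of_mul hn
    have hq0 := right_ne_zero_of_mul hn
    have hdeg := hF.totalDegree hn
    rw [totalDegree_mul_of_isDomain hd0 hq0] at hdeg
    have := comp_top d q
    rw [hdeg, homogeneousComponent_eq_self hF] at this
    exact ⟨_, this⟩
  have hu := hrel (map_dvd (phi α β) (key F₁ h1 hn1 hd1)) (map_dvd (phi α β) (key F₂ h2 hn2 hd2))
  have h0 := hom_unit _ _ (phi_hom α β _ _ (homogeneousComponent_isHomogeneous _ d)) hu
  rw [totalDegree_eq_zero_iff_eq_C] at h0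
  have hd0 : d ≠ 0 := fun h => hn1 (by simpa [h] using hd1)
  rw [h0]
  rw [h0] at hd0
  refine IsUnit.map C (Ne.isUnit ?_)
  intro hc
  simp [hc] at hd0

lemma syz (hn : F₂ ≠ 0) (hrel : IsRelPrime F₁ F₂) (a b : MvPolynomial (Fin 3) ℂ)
    (h : a * F₁ + b * F₂ = 0) : ∃ m, a = m * F₂ ∧ b = - (m * F₁) := by
  have hd : F₂ ∣ a := by
    apply hrel.symm.dvd_of_dvd_mul_right
    exact ⟨- b, by linear_combination h⟩
  obtain ⟨m, rfl⟩ := hd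
  refine ⟨m, by ring, mul_left_cancel₀ hn ?_⟩
  linear_combination h

/-- homogeneous coefficients -/
lemma hom_coeffs (h1 : F₁.IsHomogeneous e) (h2 : F₂.IsHomogeneous e) (D : ℕ)
    (K : MvPolynomial (Fin 3) ℂ) (hK : K.IsHomogeneous (D + e))
    (h : ∃ a b, K = a * F₁ + b * F₂) :
    ∃ a b, a.IsHomogeneous D ∧ b.IsHomogeneous D ∧ K = a * F₁ + b * F₂ := by
  obtain ⟨a, b, h⟩ := h
  refine ⟨homogeneousComponent D a, homogeneousComponent D b,
    homogeneousComponent_isHomogeneous _ _, homogeneousComponent_isHomogeneous _ _, ?_⟩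
  rw [← comp_mul _ _ h1, ← comp_mul _ _ h2, ← map_add, ← h, homogeneousComponent_eq_self hK]

end regular

instance homFin (n : ℕ) : FiniteDimensional ℂ (homogeneousSubmodule (Fin 3) ℂ n) :=
  Module.Finite.iff_fg.2 (homogeneousSubmodule_fg _ _ n)

/-- `(a, b) ↦ a F₁ + b F₂`. -/
def muMap (F₁ F₂ : MvPolynomial (Fin 3) ℂ) :
    (MvPolynomial (Fin 3) ℂ × MvPolynomial (Fin 3) ℂ) →ₗ[ℂ] MvPolynomial (Fin 3) ℂ :=
  (LinearMap.mulRight ℂ F₁).coprod (LinearMap.mulRight ℂ F₂)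

/-- `m ↦ (m F₂, - m F₁)`. -/
def kapMap (F₁ F₂ : MvPolynomial (Fin 3) ℂ) :
    MvPolynomial (Fin 3) ℂ →ₗ[ℂ] (MvPolynomial (Fin 3) ℂ × MvPolynomial (Fin 3) ℂ) :=
  (LinearMap.mulRight ℂ F₂).prod (-(LinearMap.mulRight ℂ F₁))

/-- Evaluation at the points of `W`. -/
def evMap (W : Set P2) : MvPolynomial (Fin 3) ℂ →ₗ[ℂ] (W → ℂ) :=
  LinearMap.pi fun p => (aeval p.1.rep : MvPolynomial (Fin 3) ℂ →ₐ[ℂ] ℂ).toLinearMap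

lemma evMap_apply (W : Set P2) (K : MvPolynomial (Fin 3) ℂ) (p : W) :
    evMap W K p = eval p.1.rep K := by
  simp [evMap, aeval_eq_eval]

lemma finrank_map_sub {V V' : Type*} [AddCommGroup V] [Module ℂ V] [AddCommGroup V'] [Module ℂ V']
    (f : V →ₗ[ℂ] V') (P : Submodule ℂ V) [FiniteDimensional ℂ P] :
    Module.finrank ℂ (P.map f) + Module.finrank ℂ (P ⊓ LinearMap.ker f : Submodule ℂ V)
      = Module.finrank ℂ P := by
  have h := LinearMap.finrank_range_add_finrank_ker (f.domRestrict P)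
  rw [LinearMap.range_domRestrict] at h
  rw [← h]
  congr 1
  have h2 : (LinearMap.ker (f.domRestrict P)).map P.subtype = P ⊓ LinearMap.ker f := by
    ext x
    simp [LinearMap.mem_ker, and_comm]
  rw [← h2]
  exact Submodule.finrank_map_subtype_eq P (LinearMap.ker (f.domRestrict P))

/-- The submodule product as a product of modules. -/
def subProdEquiv {V V' : Type*} [AddCommGroup V] [Module ℂ V] [AddCommGroup V'] [Module ℂ V']
    (A : Submodule ℂ V) (B : Submodule ℂ V') : A.prod B ≃ₗ[ℂ] A × B where
  toFun x := (⟨x.1.1, x.2.1⟩, ⟨x.1.2, x.2.2⟩)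
  invFun x := ⟨(x.1.1, x.2.1), ⟨x.1.2, x.2.2⟩⟩
  map_add' _ _ := rfl
  map_smul' _ _ := rfl
  left_inv _ := rfl
  right_inv _ := rfl

lemma AF_large {e k : ℕ} {F₁ F₂ : MvPolynomial (Fin 3) ℂ}
    (h1 : F₁.IsHomogeneous e) (h2 : F₂.IsHomogeneous e) (hn : F₂ ≠ 0) (hrel : IsRelPrime F₁ F₂)
    (W : Set P2) (hfin : W.Finite) (hcard : W.ncard = e ^ 2)
    (hW : ∀ p ∈ W, VanAt F₁ p ∧ VanAt F₂ p)
    (hsep : ∀ p ∈ W, ∃ H : MvPolynomial (Fin 3) ℂ, H.IsHomogeneous (k + e + e) ∧ ¬ VanAt H p ∧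
      ∀ q ∈ W, q ≠ p → VanAt H q)
    (K : MvPolynomial (Fin 3) ℂ) (hK : K.IsHomogeneous (k + e + e)) (hv : ∀ p ∈ W, VanAt K p) :
    ∃ a b, K = a * F₁ + b * F₂ := by
  classical
  set V := fun n => homogeneousSubmodule (Fin 3) ℂ n with hV
  let P := (V (k + e)).prod (V (k + e))
  have : Fintype W := hfin.fintype
  have eP : P ≃ₗ[ℂ] (V (k + e)) × (V (k + e)) := subProdEquiv _ _
  have hPfin : FiniteDimensional ℂ P := LinearEquiv.finiteDimensional eP.symm
  have hPdim : Module.finrank ℂ P = 2 * (k + e + 2).choose 2 := by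
    rw [eP.finrank_eq, Module.finrank_prod, finrank_hom]; ring
  have A := finrank_map_sub (muMap F₁ F₂) P
  have B := finrank_map_sub (evMap W) (V (k + e + e))
  have hker : Module.finrank ℂ (P ⊓ LinearMap.ker (muMap F₁ F₂) : Submodule ℂ _)
      ≤ (k + 2).choose 2 := by
    have hle : P ⊓ LinearMap.ker (muMap F₁ F₂) ≤ (V k).map (kapMap F₁ F₂) := by
      rintro ⟨a, b⟩ ⟨⟨ha, hb⟩, h⟩
      have h' : a * F₁ + b * F₂ = 0 := by simpa [muMap] using h
      obtain ⟨m, hm1, hm2⟩ := syz hn hrel a b h'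
      refine ⟨homogeneousComponent k m, homogeneousComponent_isHomogeneous _ _, ?_⟩
      have e1 : homogeneousComponent k m * F₂ = a := by
        rw [← comp_mul _ _ h2, ← hm1]; exact homogeneousComponent_eq_self ha
      have e2 : -(homogeneousComponent k m * F₁) = b := by
        rw [← comp_mul _ _ h1, ← map_neg, ← hm2]; exact homogeneousComponent_eq_self hb
      simp [kapMap, e1, e2]
    calc _ ≤ Module.finrank ℂ ((V k).map (kapMap F₁ F₂)) := Submodule.finrank_mono hle
      _ ≤ Module.finrank ℂ (V k) := Submodule.finrank_map_le _ _
      _ = _ := finrank_hom k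
  have hsurj : (V (k + e + e)).map (evMap W) = ⊤ := by
    rw [eq_top_iff]
    intro f _
    rw [pi_eq_sum_univ f]
    refine Submodule.sum_mem _ fun p _ => Submodule.smul_mem _ _ ?_
    obtain ⟨H, hH, hp, hq⟩ := hsep p.1 p.2
    refine ⟨C (eval p.1.rep H)⁻¹ * H, hH.C_mul _, ?_⟩
    ext q
    rw [evMap_apply]
    by_cases hpq : p = q
    · subst hpq
      simpa using inv_mul_cancel₀ hp
    · have := hq q.1 q.2 (fun h => hpq (Subtype.ext h.symm))
      simp only [VanAt] at this
      simp [this, hpq]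
  have hVN : Module.finrank ℂ (V (k + e + e)) = (k + e + e + 2).choose 2 := finrank_hom _
  rw [hsurj, finrank_top, Module.finrank_fintype_fun_eq_card, hVN,
    ← Nat.card_eq_fintype_card] at B
  change W.ncard + _ = _ at B
  rw [hcard] at B
  rw [hPdim] at A
  have hnum : (k + e + e + 2).choose 2 + (k + 2).choose 2 = e ^ 2 + 2 * (k + e + 2).choose 2 := by
    have : (((k + e + e + 2).choose 2 + (k + 2).choose 2 : ℕ) : ℚ)
      = ((e ^ 2 + 2 * (k + e + 2).choose 2 : ℕ) : ℚ) := by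
      push_cast [Nat.cast_choose_two]
      ring
    exact_mod_cast this
  have hle : P.map (muMap F₁ F₂) ≤ V (k + e + e) ⊓ LinearMap.ker (evMap W) := by
    rintro _ ⟨⟨a, b⟩, ⟨ha, hb⟩, rfl⟩
    have e1 : muMap F₁ F₂ (a, b) = a * F₁ + b * F₂ := by simp [muMap]
    rw [e1]
    refine ⟨(IsHomogeneous.mul ha h1).add (IsHomogeneous.mul hb h2), ?_⟩
    change evMap W _ = 0
    ext p
    rw [evMap_apply]
    have h3 : eval p.1.rep F₁ = 0 := (hW p.1 p.2).1
    have h4 : eval p.1.rep F₂ = 0 := (hW p.1 p.2).2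
    simp [h3, h4]
  have hfd : FiniteDimensional ℂ (V (k + e + e) ⊓ LinearMap.ker (evMap W) : Submodule ℂ _) :=
    Submodule.finiteDimensional_inf_left _ _
  have heq := Submodule.eq_of_le_of_finrank_le hle (by omega)
  have hKm : K ∈ V (k + e + e) ⊓ LinearMap.ker (evMap W) := by
    refine ⟨hK, ?_⟩
    change evMap W _ = 0
    ext p
    rw [evMap_apply]
    exact hv p.1 p.2
  rw [← heq] at hKm
  obtain ⟨⟨a, b⟩, _, h⟩ := hKm
  exact ⟨a, b, by rw [← h]; simp [muMap]⟩

lemma exists_plane (W : Set P2) (hfin : W.Finite) :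
    ∃ α β : ℂ, ∀ p ∈ W, eval p.rep (ell α β) ≠ 0 := by
  let Q : P2 → Polynomial ℂ := fun p =>
    Polynomial.C (p.rep 2) - Polynomial.C (p.rep 0) * Polynomial.X
      - Polynomial.C (p.rep 1) * Polynomial.X ^ 2
  have hQ : ∀ p, Q p ≠ 0 := by
    intro p h
    apply p.rep_nonzero
    have c0 := congrArg (fun q => Polynomial.coeff q 0) h
    have c1 := congrArg (fun q => Polynomial.coeff q 1) h
    have c2 := congrArg (fun q => Polynomial.coeff q 2) h
    simp [Q, Polynomial.coeff_X, Polynomial.coeff_X_pow, Polynomial.coeff_C] at c0 c1 c2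
    ext i
    fin_cases i <;> simp [c0, c1, c2]
  have hprod : ∏ p ∈ hfin.toFinset, Q p ≠ 0 := Finset.prod_ne_zero_iff.2 fun p _ => hQ p
  obtain ⟨t, ht⟩ : ∃ t, Polynomial.eval t (∏ p ∈ hfin.toFinset, Q p) ≠ 0 := by
    by_contra! hcon
    exact hprod (Polynomial.funext (by simpa using hcon))
  refine ⟨t, t ^ 2, fun p hp => ?_⟩
  rw [Polynomial.eval_prod, Finset.prod_ne_zero_iff] at ht
  have := ht p (by simpa using hp)
  simp only [Q, Polynomial.eval_sub, Polynomial.eval_mul, Polynomial.eval_C, Polynomial.eval_X,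
    Polynomial.eval_pow] at this
  intro h
  apply this
  simp [ell] at h
  linear_combination h

lemma sep_lin (p q : P2) (h : q ≠ p) : ∃ L : MvPolynomial (Fin 3) ℂ, L.IsHomogeneous 1 ∧
    ¬ VanAt L p ∧ VanAt L q := by
  by_contra! hcon
  have hc : ∀ i j, q.rep j * p.rep i = q.rep i * p.rep j := by
    intro i j
    by_contra hne
    refine hcon (C (q.rep j) * X i - C (q.rep i) * X j)
      ((isHomogeneous_C_mul_X _ _).sub (isHomogeneous_C_mul_X _ _)) ?_ ?_
    · simp only [VanAt]; simpa [sub_eq_zero] using hne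
    · simp only [VanAt]; simp; ring
  obtain ⟨i, hi⟩ := Function.ne_iff.1 p.rep_nonzero
  apply h
  rw [← q.mk_rep, ← p.mk_rep, Projectivization.mk_eq_mk_iff']
  refine ⟨q.rep i / p.rep i, ?_⟩
  ext j
  simp at hi ⊢
  field_simp
  linear_combination -hc i j

lemma eval_smul_hom (F : MvPolynomial (Fin 3) ℂ) (n : ℕ) (hF : F.IsHomogeneous n) (v : Fin 3 → ℂ)
    (a : ℂ) : eval (a • v) F = a ^ n * eval v F := by
  rw [eval_eq', eval_eq', Finset.mul_sum]
  refine Finset.sum_congr rfl fun d hd => ?_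
  have hdeg : d.degree = n := by
    by_contra hne
    exact (mem_support_iff.1 hd) (hF.coeff_eq_zero hne)
  rw [← hdeg, Finsupp.degree_eq_sum, ← Finset.prod_pow_eq_pow_sum]
  simp only [Pi.smul_apply, smul_eq_mul, mul_pow, Finset.prod_mul_distrib]
  ring

lemma vanAt_of_vec (F : MvPolynomial (Fin 3) ℂ) (n : ℕ) (hF : F.IsHomogeneous n) (v : Fin 3 → ℂ)
    (hv : v ≠ 0) : VanAt F (Projectivization.mk ℂ v hv) ↔ eval v F = 0 := by
  obtain ⟨a, ha⟩ := Projectivization.exists_smul_eq_mk_rep ℂ v hv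
  have key : eval (Projectivization.mk ℂ v hv).rep F = (a : ℂ) ^ n * eval v F := by
    rw [← ha]
    exact eval_smul_hom F n hF v a
  simp [VanAt, key]


lemma AF_all {e d : ℕ} (he : e ≠ 0) {F₁ F₂ : MvPolynomial (Fin 3) ℂ}
    (h1 : F₁.IsHomogeneous e) (h2 : F₂.IsHomogeneous e)
    {α β : ℂ} (hrel : IsRelPrime (phi α β F₁) (phi α β F₂))
    (W : Set P2) (hfin : W.Finite) (hcard : W.ncard = e ^ 2)
    (hW : ∀ p ∈ W, VanAt F₁ p ∧ VanAt F₂ p)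
    (hell : ∀ p ∈ W, eval p.rep (ell α β) ≠ 0)
    (K : MvPolynomial (Fin 3) ℂ) (hK : K.IsHomogeneous d) (hv : ∀ p ∈ W, VanAt K p) :
    ∃ a b, K = a * F₁ + b * F₂ := by
  classical
  have hn2 : F₂ ≠ 0 := fun h => ne_zero_of_rel he h1 hrel (by simp [h])
  obtain ⟨k, hk⟩ : ∃ k, k = e ^ 2 + d := ⟨_, rfl⟩
  apply ell_pow_regular he h1 hrel (k + e + e - d)
  apply AF_large (k := k) h1 h2 hn2 (rel3 he h1 h2 hrel) W hfin hcard hW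
  · intro p hp
    choose L hL1 hL2 hL3 using fun q : {q : P2 // q ≠ p} => sep_lin p q.1 q.2
    let L' : P2 → MvPolynomial (Fin 3) ℂ := fun q => if h : q ≠ p then L ⟨q, h⟩ else 1
    let T := hfin.toFinset.erase p
    have hT : T.card ≤ e ^ 2 := by
      rw [← hcard, Set.ncard_eq_toFinset_card W hfin]
      exact Finset.card_le_card (Finset.erase_subset _ _)
    have hprod : (∏ q ∈ T, L' q).IsHomogeneous T.card := by
      have := IsHomogeneous.prod T L' (fun _ => 1) (by
        intro q hq
        have hq' : q ≠ p := Finset.ne_of_mem_erase hq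
        simp only [L', dif_pos hq']
        exact hL1 _)
      simpa using this
    refine ⟨(∏ q ∈ T, L' q) * ell α β ^ (k + e + e - T.card), ?_, ?_, ?_⟩
    · have := hprod.mul ((ell_hom α β).pow (k + e + e - T.card))
      convert this using 1
      omega
    · simp only [VanAt, map_mul, map_pow, map_prod]
      refine mul_ne_zero (Finset.prod_ne_zero_iff.2 ?_) (pow_ne_zero _ (hell p hp))
      intro q hq
      have hq' : q ≠ p := Finset.ne_of_mem_erase hq
      simp only [L', dif_pos hq']
      exact hL2 _
    · intro q hq hqp
      simp only [VanAt, map_mul, map_pow, map_prod]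
      rw [Finset.prod_eq_zero (i := q), zero_mul]
      · exact Finset.mem_erase.2 ⟨hqp, by simpa using hq⟩
      · simp only [L', dif_pos hqp]
        exact hL3 ⟨q, hqp⟩
  · have := ((ell_hom α β).pow (k + e + e - d)).mul hK
    convert this using 1
    omega
  · intro p hp
    have := hv p hp
    simp only [VanAt] at this ⊢
    simp [this]

/-- Two independent linear forms through a point. -/
lemma two_lines (p : P2) : ∃ L M : MvPolynomial (Fin 3) ℂ, L.IsHomogeneous 1 ∧ M.IsHomogeneous 1 ∧
    VanAt L p ∧ VanAt M p ∧ L ≠ 0 ∧ M ≠ 0 ∧ IsRelPrime L M := by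
  obtain ⟨i, hi⟩ := Function.ne_iff.1 p.rep_nonzero
  simp only [Pi.zero_apply] at hi
  obtain ⟨j, k, hij, hik, hjk⟩ : ∃ j k : Fin 3, i ≠ j ∧ i ≠ k ∧ j ≠ k := by
    fin_cases i
    · exact ⟨1, 2, by decide, by decide, by decide⟩
    · exact ⟨0, 2, by decide, by decide, by decide⟩
    · exact ⟨0, 1, by decide, by decide, by decide⟩
  let N : Fin 3 → MvPolynomial (Fin 3) ℂ := fun j => C (p.rep i) * X j - C (p.rep j) * X i
  have hN : ∀ j, (N j).IsHomogeneous 1 := fun j =>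
    (isHomogeneous_C_mul_X _ _).sub (isHomogeneous_C_mul_X _ _)
  have hv : ∀ j, VanAt (N j) p := by
    intro j
    simp only [VanAt, N]
    simp
    ring
  have hev : ∀ j k, i ≠ j → eval (Pi.single j 1) (N k) = if k = j then p.rep i else 0 := by
    intro j k h
    simp [N, Pi.single_apply, h]
  have hne : ∀ j, i ≠ j → N j ≠ 0 := by
    intro j h h0
    have := hev j j h
    rw [h0] at this
    simp at this
    exact hi this.symm
  have hirr : ∀ j, i ≠ j → Irreducible (N j) := by
    intro j h
    apply irreducible_of_totalDegree_eq_one ((hN j).totalDegree (hne j h))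
    intro x hx
    rw [isUnit_iff_ne_zero]
    rintro rfl
    apply hne j h
    ext d
    simpa using hx d
  refine ⟨N j, N k, hN j, hN k, hv j, hv k, hne j hij, hne k hik, ?_⟩
  rw [(hirr j hij).isRelPrime_iff_not_dvd]
  rintro ⟨q, hq⟩
  have := congrArg (eval (Pi.single k 1)) hq
  rw [map_mul, hev k k hik, hev k j hik, if_pos rfl, if_neg hjk, zero_mul] at this
  exact hi this

/-- Cayley–Bacharach. -/
lemma cayley_bacharach {n : ℕ} {F₁ F₂ : MvPolynomial (Fin 3) ℂ}
    (h1 : F₁.IsHomogeneous (n + 2)) (h2 : F₂.IsHomogeneous (n + 2))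
    (hfin : (zeroSet F₁ F₂).Finite) (hcard : (zeroSet F₁ F₂).ncard = (n + 2) ^ 2)
    (p : P2) (hp : p ∈ zeroSet F₁ F₂)
    (K : MvPolynomial (Fin 3) ℂ) (hK : K.IsHomogeneous (n + n + 1))
    (hv : ∀ q ∈ zeroSet F₁ F₂, q ≠ p → VanAt K q) : VanAt K p := by
  obtain ⟨α, β, hell⟩ := exists_plane _ hfin
  have he : n + 2 ≠ 0 := by omega
  have hrel : IsRelPrime (phi α β F₁) (phi α β F₂) := by
    apply relprime_of_zeros
    intro v hv1 hv2
    rw [eval_phi] at hv1 hv2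
    by_contra hne
    have hw : (![v 0, v 1, α * v 0 + β * v 1] : Fin 3 → ℂ) ≠ 0 := by
      intro h0
      apply hne
      ext i
      fin_cases i
      · simpa using congrFun h0 0
      · simpa using congrFun h0 1
    have := hell (Projectivization.mk ℂ _ hw)
      ⟨(vanAt_of_vec _ _ h1 _ hw).2 hv1, (vanAt_of_vec _ _ h2 _ hw).2 hv2⟩
    apply this
    apply (vanAt_of_vec _ _ (ell_hom α β) _ hw).2
    simp [ell]
  have hn2 : F₂ ≠ 0 := fun h => ne_zero_of_rel he h1 hrel (by simp [h])
  obtain ⟨L, M, hL, hM, hLp, hMp, hL0, hM0, hLM⟩ := two_lines p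
  have key : ∀ L : MvPolynomial (Fin 3) ℂ, L.IsHomogeneous 1 → VanAt L p →
      ∃ a b, a.IsHomogeneous n ∧ b.IsHomogeneous n ∧ L * K = a * F₁ + b * F₂ := by
    intro L hL hLp
    have hLK : (L * K).IsHomogeneous (n + (n + 2)) := by
      convert hL.mul hK using 1
      omega
    apply hom_coeffs h1 h2 n _ hLK
    apply AF_all he h1 h2 hrel _ hfin hcard (fun q hq => hq) hell _ hLK
    intro q hq
    by_cases hqp : q = p
    · subst hqp
      simp only [VanAt] at hLp ⊢
      simp [hLp]
    · have := hv q hq hqp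
      simp only [VanAt] at this ⊢
      simp [this]
  obtain ⟨a, b, ha, hb, hab⟩ := key L hL hLp
  obtain ⟨c, d, hc, hd, hcd⟩ := key M hM hMp
  obtain ⟨m, hm1, hm2⟩ := syz hn2 (rel3 he h1 h2 hrel) (M * a - L * c) (M * b - L * d)
    (by linear_combination L * hcd - M * hab)
  have hm : m = 0 := by
    by_contra hm0
    have hdeg : (M * a - L * c).IsHomogeneous (1 + n) := (hM.mul ha).sub (hL.mul hc)
    have h3 := hdeg.totalDegree_le
    rw [hm1, totalDegree_mul_of_isDomain hm0 hn2, h2.totalDegree hn2] at h3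
    omega
  rw [hm, zero_mul] at hm1 hm2
  rw [neg_zero] at hm2
  obtain ⟨a', ha'⟩ : L ∣ a := hLM.dvd_of_dvd_mul_left ⟨c, by linear_combination hm1⟩
  obtain ⟨b', hb'⟩ : L ∣ b := hLM.dvd_of_dvd_mul_left ⟨d, by linear_combination hm2⟩
  have hKeq : K = a' * F₁ + b' * F₂ := by
    apply mul_left_cancel₀ hL0
    rw [hab, ha', hb']; ring
  have e1 : eval p.rep F₁ = 0 := hp.1
  have e2 : eval p.rep F₂ = 0 := hp.2
  rw [hKeq]
  simp [VanAt, e1, e2]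

theorem stmt_4 (e : ℕ) (he : 2 ≤ e) (F₁ F₂ : MvPolynomial (Fin 3) ℂ)
    (h1 : F₁.IsHomogeneous e) (h2 : F₂.IsHomogeneous e)
    (hfin : (zeroSet F₁ F₂).Finite) (hcard : (zeroSet F₁ F₂).ncard = e ^ 2)
    (W₁ W₂ : Set P2) (hdisj : Disjoint W₁ W₂) (hunion : W₁ ∪ W₂ = zeroSet F₁ F₂)
    (hc1 : W₁.ncard = (e + 1).choose 2) (hc2 : W₂.ncard = e.choose 2)
    (hW₁ : ∀ G : MvPolynomial (Fin 3) ℂ, G.IsHomogeneous (e - 1) →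
      (∀ p ∈ W₁, VanAt G p) → G = 0) :
    ∀ G : MvPolynomial (Fin 3) ℂ, G.IsHomogeneous (e - 2) →
      (∀ p ∈ W₂, VanAt G p) → G = 0 := by
  obtain ⟨n, rfl⟩ : ∃ n, e = n + 2 := ⟨e - 2, by omega⟩
  have hs1 : n + 2 - 1 = n + 1 := by omega
  have hs2 : n + 2 - 2 = n := by omega
  rw [hs1] at hW₁
  rw [hs2]
  intro G hG hGv
  classical
  have hsub1 : W₁ ⊆ zeroSet F₁ F₂ := hunion ▸ Set.subset_union_left
  have : Fintype W₁ := (hfin.subset hsub1).fintype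
  let f := (evMap W₁).domRestrict (homogeneousSubmodule (Fin 3) ℂ (n + 1))
  have hinj : Function.Injective f := by
    rw [← LinearMap.ker_eq_bot, LinearMap.ker_eq_bot']
    rintro ⟨H, hH⟩ h0
    have := hW₁ H hH (fun p hp => by
      have := congrFun h0 ⟨p, hp⟩
      simpa [f, evMap_apply, VanAt] using this)
    exact Subtype.ext this
  have hdim : Module.finrank ℂ (homogeneousSubmodule (Fin 3) ℂ (n + 1))
      = Module.finrank ℂ (W₁ → ℂ) := by
    rw [finrank_hom, Module.finrank_fintype_fun_eq_card, ← Nat.card_eq_fintype_card]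
    exact hc1.symm
  have hsurj : Function.Surjective f :=
    (LinearMap.injective_iff_surjective_of_finrank_eq_finrank hdim).1 hinj
  have hG1 : ∀ p ∈ W₁, VanAt G p := by
    intro p hp
    obtain ⟨⟨H, hH⟩, hHp⟩ := hsurj (Pi.single ⟨p, hp⟩ 1)
    have hHe : ∀ q (hq : q ∈ W₁), eval q.rep H = if q = p then 1 else 0 := by
      intro q hq
      have := congrFun hHp ⟨q, hq⟩
      simpa [f, evMap_apply, Pi.single_apply] using this
    have hGH : (G * H).IsHomogeneous (n + n + 1) := by
      rw [add_assoc]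
      exact IsHomogeneous.mul hG hH
    have := cayley_bacharach h1 h2 hfin hcard p (hsub1 hp) (G * H) hGH (by
      intro q hq hqp
      rw [← hunion] at hq
      rcases hq with hq | hq
      · simp [VanAt, hHe q hq, hqp]
      · have := hGv q hq
        simp only [VanAt] at this ⊢
        simp [this])
    simpa [VanAt, hHe p hp] using this
  have hz := hW₁ (G * X 0) (hG.mul (isHomogeneous_X _ _)) (by
    intro p hp
    have := hG1 p hp
    simp only [VanAt] at this ⊢
    simp [this])
  exact (mul_eq_zero.1 hz).resolve_right (X_ne_zero _)

end
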